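/- Let s and v be complex numbers with Re s > 1, s ≠ 2 and Re v > 0. Then Σ_{n=0}^∞ (n+v)^{−s} = (2/((s−1)(s−2))) Σ_{n=0}^∞ (H_{n+1}/(n+2)) Σ_{l=0}^{n+1} (−1)^l C(n+1,l) (l+v)^{2−s}, the outer series on the right being convergent, where H_n = Σ_{j=1}^n 1/j is the n-th harmonic number. -/

import Mathlib

open Filter Finset MeasureTheory
open Set (Ioi)

theorem integrableOn_rpow_mul_exp_neg_mul {p a : ℝ} (hp : 0 < p) (ha : 0 < a) :
    IntegrableOn (fun t : ℝ => t ^ (p - 1) * Real.exp (-a * t)) (Ioi 0) := by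
  simpa using integrableOn_rpow_mul_exp_neg_mul_rpow (p := 1) (s := p - 1) (by linarith) one_pos ha

theorem norm_cpow_mul_cexp {t : ℝ} (ht : 0 < t) (s v : ℂ) :
    ‖(t : ℂ) ^ s * Complex.exp (-(v * t))‖ = t ^ s.re * Real.exp (-v.re * t) := by
  rw [norm_mul, Complex.norm_cpow_eq_rpow_re_of_pos ht, Complex.norm_exp]
  simp

theorem continuousOn_cpow_mul_cexp (s v : ℂ) :
    ContinuousOn (fun t : ℝ => (t : ℂ) ^ s * Complex.exp (-(v * t))) (Ioi 0) := by
  refine ContinuousOn.mul (fun t ht => ?_) (by fun_prop)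
  exact (Complex.continuousAt_ofReal_cpow_const t s (Or.inr (ne_of_gt ht))).continuousWithinAt

theorem integrableOn_cpow_mul_cexp {s v : ℂ} (hs : 0 < s.re) (hv : 0 < v.re) :
    IntegrableOn (fun t : ℝ => (t : ℂ) ^ (s - 1) * Complex.exp (-(v * t))) (Ioi 0) := by
  refine Integrable.mono' (integrableOn_rpow_mul_exp_neg_mul hs hv)
    ((continuousOn_cpow_mul_cexp _ _).aestronglyMeasurable measurableSet_Ioi) ?_
  filter_upwards [ae_restrict_mem measurableSet_Ioi] with t ht
  rw [norm_cpow_mul_cexp ht]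
  simp

theorem differentiableAt_integral_cpow_mul_cexp {s v : ℂ} (hs : 0 < s.re) (hv : 0 < v.re) :
    DifferentiableAt ℂ
      (fun z : ℂ => ∫ t : ℝ in Ioi 0, (t : ℂ) ^ (s - 1) * Complex.exp (-(z * t))) v := by
  have hopen : IsOpen {z : ℂ | v.re / 2 < z.re} := isOpen_lt continuous_const Complex.continuous_re
  refine (hasDerivAt_integral_of_dominated_loc_of_deriv_le
    (F := fun z (t : ℝ) => (t : ℂ) ^ (s - 1) * Complex.exp (-(z * t)))
    (F' := fun z t => (t : ℂ) ^ (s - 1) * (Complex.exp (-(z * t)) * -t))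
    (bound := fun t => t ^ (s.re + 1 - 1) * Real.exp (-(v.re / 2) * t))
    (hopen.mem_nhds (half_lt_self hv)) (Eventually.of_forall fun z =>
      (continuousOn_cpow_mul_cexp _ _).aestronglyMeasurable measurableSet_Ioi)
    (integrableOn_cpow_mul_cexp hs hv) ?_ ?_
    (integrableOn_rpow_mul_exp_neg_mul (by linarith) (half_pos hv)) ?_).2.differentiableAt
  · simp_rw [← mul_assoc]
    exact ((continuousOn_cpow_mul_cexp _ _).mul (by fun_prop)).aestronglyMeasurable
      measurableSet_Ioi
  · filter_upwards [ae_restrict_mem measurableSet_Ioi] with t (ht : 0 < t) z hz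
    rw [← mul_assoc, norm_mul, norm_cpow_mul_cexp ht, norm_neg, Complex.norm_real,
      Real.norm_of_nonneg ht.le, mul_right_comm, ← Real.rpow_add_one ht.ne']
    simp only [Complex.sub_re, Complex.one_re, sub_add_cancel, add_sub_cancel_right]
    gcongr
  · refine Eventually.of_forall fun t z _ => HasDerivAt.const_mul _ (HasDerivAt.cexp ?_)
    simpa using! ((hasDerivAt_id z).mul_const (t : ℂ)).neg

theorem integral_cpow_mul_cexp {s v : ℂ} (hs : 0 < s.re) (hv : 0 < v.re) :
    ∫ t : ℝ in Ioi 0, (t : ℂ) ^ (s - 1) * Complex.exp (-(v * t)) = v ^ (-s) * Complex.Gamma s := by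
  have hopen : IsOpen {z : ℂ | 0 < z.re} := isOpen_lt continuous_const Complex.continuous_re
  refine AnalyticOnNhd.eqOn_of_preconnected_of_frequently_eq (U := {z : ℂ | 0 < z.re}) (z₀ := 1)
    (f := fun z : ℂ => ∫ t : ℝ in Ioi 0, (t : ℂ) ^ (s - 1) * Complex.exp (-(z * t)))
    (g := fun z : ℂ => z ^ (-s) * Complex.Gamma s) ?_ ?_
    (convex_halfSpace_re_gt 0).isPreconnected (by simp) ?_ hv
  · exact DifferentiableOn.analyticOnNhd (fun z hz =>
      (differentiableAt_integral_cpow_mul_cexp hs hz).differentiableWithinAt) hopen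
  · refine DifferentiableOn.analyticOnNhd (fun z hz => ?_) hopen
    exact ((differentiableAt_id.cpow_const (Or.inl hz)).mul_const _).differentiableWithinAt
  · have hpos : ∀ᶠ r : ℝ in nhdsWithin 1 {1}ᶜ, 0 < r :=
      (eventually_gt_nhds one_pos).filter_mono nhdsWithin_le_nhds
    have htend : Tendsto ((↑) : ℝ → ℂ) (nhdsWithin 1 {1}ᶜ) (nhdsWithin 1 {1}ᶜ) := by
      refine tendsto_nhdsWithin_iff.2 ⟨?_, ?_⟩
      · exact (Complex.continuous_ofReal.tendsto' 1 1 Complex.ofReal_one).mono_left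
          nhdsWithin_le_nhds
      · filter_upwards [self_mem_nhdsWithin] with r hr
        simpa using hr
    refine htend.frequently (hpos.mono fun r hr => ?_).frequently
    rw [Complex.integral_cpow_mul_exp_neg_mul_Ioi hs hr, one_div, Complex.inv_cpow,
      Complex.cpow_neg]
    rw [Complex.arg_ofReal_of_nonneg hr.le]
    exact Real.pi_ne_zero.symm

theorem one_sub_exp_neg_pos {t : ℝ} (ht : 0 < t) : 0 < 1 - Real.exp (-t) := by
  simpa using ht

theorem one_sub_exp_neg_inv_le {t : ℝ} (ht : 0 < t) : (1 - Real.exp (-t))⁻¹ ≤ (1 + t) / t := by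
  rw [inv_le_comm₀ (one_sub_exp_neg_pos ht) (by positivity), inv_div, Real.exp_neg]
  have h : (Real.exp t)⁻¹ ≤ (t + 1)⁻¹ := inv_anti₀ (by linarith) (Real.add_one_le_exp t)
  have : t / (1 + t) = 1 - (t + 1)⁻¹ := by field_simp; ring
  linarith

theorem integrableOn_rpow_mul_exp_div_one_sub_exp {p a : ℝ} (hp : 1 < p) (ha : 0 < a) :
    IntegrableOn (fun t : ℝ => t ^ (p - 1) * Real.exp (-a * t) * (1 - Real.exp (-t))⁻¹)
      (Ioi 0) := by
  refine Integrable.mono' ((integrableOn_rpow_mul_exp_neg_mul (p := p - 1) (by linarith) ha).add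
    (integrableOn_rpow_mul_exp_neg_mul (p := p) (by linarith) ha)) ?_ ?_
  · refine ContinuousOn.aestronglyMeasurable (fun t ht => ?_) measurableSet_Ioi
    have h0 := (one_sub_exp_neg_pos ht).ne'
    have h1 : t ≠ 0 := ne_of_gt ht
    exact ContinuousAt.continuousWithinAt (by fun_prop (disch := simp [*]))
  · filter_upwards [ae_restrict_mem measurableSet_Ioi] with t (ht : 0 < t)
    have h0 := one_sub_exp_neg_pos ht
    rw [Real.norm_of_nonneg (by positivity)]
    refine (mul_le_mul_of_nonneg_left (one_sub_exp_neg_inv_le ht) (by positivity)).trans_eq ?_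
    simp only [Pi.add_apply]
    rw [Real.rpow_sub_one ht.ne' (p - 1)]
    field_simp

theorem hasSum_integral_cpow_mul_cexp_mul {s v : ℂ} (hs : 1 < s.re) (hv : 0 < v.re)
    {g : ℕ → ℝ → ℝ} (hg0 : ∀ n, ∀ t > 0, 0 ≤ g n t) (hgc : ∀ n, ContinuousOn (g n) (Ioi 0))
    (hg : ∀ t > 0, HasSum (fun n => g n t) (1 - Real.exp (-t))⁻¹) :
    HasSum (fun n => ∫ t : ℝ in Ioi 0, (t : ℂ) ^ (s - 1) * Complex.exp (-(v * t)) * (g n t : ℂ))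
      (∫ t : ℝ in Ioi 0, (t : ℂ) ^ (s - 1) * Complex.exp (-(v * t)) *
        (((1 - Real.exp (-t))⁻¹ : ℝ) : ℂ)) := by
  refine hasSum_integral_of_dominated_convergence
    (fun n t => t ^ (s.re - 1) * Real.exp (-v.re * t) * g n t) (fun n => ?_) (fun n => ?_) ?_ ?_ ?_
  · exact ((continuousOn_cpow_mul_cexp _ _).mul
      (Complex.continuous_ofReal.comp_continuousOn (hgc n))).aestronglyMeasurable measurableSet_Ioi
  · filter_upwards [ae_restrict_mem measurableSet_Ioi] with t ht
    rw [norm_mul, norm_cpow_mul_cexp ht, Complex.norm_real, Real.norm_of_nonneg (hg0 n t ht)]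
    simp
  · filter_upwards [ae_restrict_mem measurableSet_Ioi] with t ht
    exact (hg t ht).summable.mul_left _
  · refine (integrableOn_rpow_mul_exp_div_one_sub_exp hs hv).congr ?_
    filter_upwards [ae_restrict_mem measurableSet_Ioi] with t ht
    exact ((hg t ht).mul_left _).tsum_eq.symm
  · filter_upwards [ae_restrict_mem measurableSet_Ioi] with t ht
    exact ((Complex.hasSum_ofReal.2 (hg t ht))).mul_left _

theorem hasSum_hurwitz_mul_Gamma {s v : ℂ} (hs : 1 < s.re) (hv : 0 < v.re) :
    HasSum (fun n : ℕ => ((n : ℂ) + v) ^ (-s) * Complex.Gamma s)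
      (∫ t : ℝ in Ioi 0, (t : ℂ) ^ (s - 1) * Complex.exp (-(v * t)) *
        (((1 - Real.exp (-t))⁻¹ : ℝ) : ℂ)) := by
  convert! hasSum_integral_cpow_mul_cexp_mul hs hv (g := fun n t => Real.exp (-t) ^ n)
    (fun n t _ => by positivity) (fun n => by fun_prop)
    (fun t ht => hasSum_geometric_of_lt_one (Real.exp_pos _).le (by simpa using ht)) using 2 with n
  rw [← integral_cpow_mul_cexp (by linarith) (by simp; positivity)]
  congr 1 with t
  rw [mul_assoc]
  push_cast
  rw [← Complex.exp_nat_mul, ← Complex.exp_add]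
  ring_nf

theorem sum_inv_mul_inv_eq_harmonic (n : ℕ) :
    ∑ k ∈ range (n + 1), 1 / (((k : ℝ) + 1) * (((n - k : ℕ) : ℝ) + 1)) =
      2 * (harmonic (n + 1) : ℝ) / (n + 2) := by
  have h : (harmonic (n + 1) : ℝ) = ∑ k ∈ range (n + 1), 1 / ((k : ℝ) + 1) := by
    simp [harmonic]
  have h' : (harmonic (n + 1) : ℝ) = ∑ k ∈ range (n + 1), 1 / (((n - k : ℕ) : ℝ) + 1) := by
    rw [h, ← sum_range_reflect]
    simp
  rw [two_mul]
  nth_rw 1 [h]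
  rw [h', ← sum_add_distrib, sum_div]
  refine sum_congr rfl fun k hk => ?_
  rw [Nat.cast_sub (by simpa [Nat.lt_succ_iff] using hk)]
  have : (n : ℝ) - k + 1 ≠ 0 := by
    have : (k : ℝ) ≤ n := by exact_mod_cast (by simpa [Nat.lt_succ_iff] using hk : k ≤ n)
    linarith
  field_simp
  ring

theorem hasSum_harmonic_mul_pow {x : ℝ} (hx : |x| < 1) :
    HasSum (fun n : ℕ => 2 * (harmonic (n + 1) : ℝ) / (n + 2) * x ^ (n + 2))
      (Real.log (1 - x) ^ 2) := by
  have h := Real.hasSum_pow_div_log_of_abs_lt_one hx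
  convert! hasSum_sum_range_mul_of_summable_norm h.summable.norm h.summable.norm using 2 with n
  · rw [← sum_inv_mul_inv_eq_harmonic, sum_mul]
    refine sum_congr rfl fun k hk => ?_
    have : n + 2 = (k + 1) + (n - k + 1) := by simp at hk; omega
    rw [this, pow_add]
    field_simp
  · rw [h.tsum_eq]; ring

theorem hasSum_integral_harmonic {s v : ℂ} (hs : 1 < s.re) (hv : 0 < v.re) :
    HasSum (fun n : ℕ => 2 * (harmonic (n + 1) : ℂ) / (n + 2) *
        ∫ t : ℝ in Ioi 0, (t : ℂ) ^ (s - 3) *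
          (Complex.exp (-(v * t)) * (1 - Complex.exp (-t)) ^ (n + 1)))
      (∫ t : ℝ in Ioi 0, (t : ℂ) ^ (s - 1) * Complex.exp (-(v * t)) *
        (((1 - Real.exp (-t))⁻¹ : ℝ) : ℂ)) := by
  convert! hasSum_integral_cpow_mul_cexp_mul hs hv
    (g := fun n t => 2 * (harmonic (n + 1) : ℝ) / (n + 2) * (1 - Real.exp (-t)) ^ (n + 1) / t ^ 2)
    (fun n t ht => ?_) (fun n => ?_) (fun t ht => ?_) using 2 with n
  · rw [← integral_const_mul]
    refine setIntegral_congr_fun measurableSet_Ioi fun t ht => ?_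
    have ht' : (t : ℂ) ≠ 0 := by exact_mod_cast (ne_of_gt ht)
    have : (t : ℂ) ^ (s - 1) = (t : ℂ) ^ (s - 3) * (t : ℂ) ^ 2 := by
      rw [← Complex.cpow_ofNat, ← Complex.cpow_add _ _ ht']; congr 1; ring
    simp only [this]
    push_cast
    field_simp
  · have := one_sub_exp_neg_pos ht
    have h : (0 : ℝ) ≤ (harmonic (n + 1) : ℝ) := by
      exact_mod_cast (harmonic_pos (Nat.succ_ne_zero n)).le
    positivity
  · refine ContinuousOn.div (by fun_prop) (by fun_prop) fun t ht => ?_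
    exact pow_ne_zero _ (ne_of_gt ht)
  · have h1 := one_sub_exp_neg_pos ht
    have h2 := Real.exp_pos (-t)
    have h := (hasSum_harmonic_mul_pow (x := 1 - Real.exp (-t))
      (by rw [abs_of_pos h1]; linarith)).div_const (t ^ 2 * (1 - Real.exp (-t)))
    have ht' := ne_of_gt ht
    convert! h using 1
    · ext n
      rw [pow_succ _ (n + 1)]
      field_simp
    · rw [sub_sub_cancel, Real.log_exp, neg_sq]
      field_simp

theorem sum_neg_one_pow_choose_mul_cexp (m : ℕ) (v : ℂ) (t : ℂ) :
    ∑ l ∈ range (m + 1), (-1) ^ l * (m.choose l : ℂ) * Complex.exp (-((l + v) * t)) =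
      Complex.exp (-(v * t)) * (1 - Complex.exp (-t)) ^ m := by
  rw [sub_eq_neg_add, add_pow, mul_sum]
  refine sum_congr rfl fun l _ => ?_
  rw [neg_pow (Complex.exp _), ← Complex.exp_nat_mul, add_mul, neg_add, Complex.exp_add]
  simp
  ring

theorem norm_cpow_mul_cexp_mul_pow_le {s v : ℂ} (n : ℕ) {t : ℝ} (ht : 0 < t) :
    ‖(t : ℂ) ^ s * (Complex.exp (-(v * t)) * (1 - Complex.exp (-t)) ^ (n + 1))‖ ≤
      t ^ (s.re + 1) * Real.exp (-v.re * t) := by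
  have h0 := one_sub_exp_neg_pos ht
  have h1 : 1 - Real.exp (-t) ≤ t := by linarith [Real.add_one_le_exp (-t)]
  have h2 : (1 - Real.exp (-t)) ^ n ≤ 1 :=
    pow_le_one₀ h0.le (by linarith [Real.exp_pos (-t)])
  have h3 : (1 - Real.exp (-t)) ^ (n + 1) ≤ t := by
    rw [pow_succ]
    exact (mul_le_of_le_one_left h0.le h2).trans h1
  have h4 : ‖(1 - Complex.exp (-t)) ^ (n + 1)‖ = (1 - Real.exp (-t)) ^ (n + 1) := by
    rw [norm_pow, ← Complex.ofReal_neg, ← Complex.ofReal_exp, ← Complex.ofReal_one,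
      ← Complex.ofReal_sub, Complex.norm_real, Real.norm_of_nonneg h0.le]
  rw [← mul_assoc, norm_mul, norm_cpow_mul_cexp ht, h4, Real.rpow_add_one ht.ne', mul_right_comm]
  gcongr

theorem integral_cpow_mul_cexp_mul_pow {s v : ℂ} (hs : 1 < s.re) (hs2 : s ≠ 2) (hv : 0 < v.re)
    (n : ℕ) :
    (s - 2) * ∫ t : ℝ in Ioi 0, (t : ℂ) ^ (s - 3) *
        (Complex.exp (-(v * t)) * (1 - Complex.exp (-t)) ^ (n + 1)) =
      Complex.Gamma (s - 1) * ∑ l ∈ range (n + 2), (-1) ^ l * ((n + 1).choose l : ℂ) *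
        ((l : ℂ) + v) ^ (2 - s) := by
  have hlv (l : ℕ) : 0 < ((l : ℂ) + v).re := by simp; positivity
  have hs1 : 0 < (s - 1).re := by simpa using hs
  have hint (l : ℕ) : IntegrableOn (fun t : ℝ => (-1) ^ l * ((n + 1).choose l : ℂ) *
      -(l + v) * ((t : ℂ) ^ (s - 1 - 1) * Complex.exp (-((l + v) * t)))) (Ioi 0) :=
    (integrableOn_cpow_mul_cexp hs1 (hlv l)).const_mul _
  have hF (t : ℝ) : HasDerivAt
      (fun t : ℝ => Complex.exp (-(v * t)) * (1 - Complex.exp (-t)) ^ (n + 1))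
      (∑ l ∈ range (n + 2), (-1) ^ l * ((n + 1).choose l : ℂ) *
        (Complex.exp (-((l + v) * t)) * -(l + v))) t := by
    simp_rw [← sum_neg_one_pow_choose_mul_cexp (n + 1) v]
    refine HasDerivAt.fun_sum fun l _ => HasDerivAt.const_mul _ (HasDerivAt.cexp ?_)
    simpa using! ((hasDerivAt_id t).ofReal_comp.const_mul ((l : ℂ) + v)).neg
  have hexpand (t : ℝ) : (t : ℂ) ^ (s - 2) * (∑ l ∈ range (n + 2),
      (-1) ^ l * ((n + 1).choose l : ℂ) * (Complex.exp (-((l + v) * t)) * -(l + v))) =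
      ∑ l ∈ range (n + 2), (-1) ^ l * ((n + 1).choose l : ℂ) * -(l + v) *
        ((t : ℂ) ^ (s - 1 - 1) * Complex.exp (-((l + v) * t))) := by
    rw [mul_sum, show s - 1 - 1 = s - 2 by ring]
    exact sum_congr rfl fun l _ => by ring
  have hbd (t : ℝ) (ht : 0 < t) := norm_cpow_mul_cexp_mul_pow_le (s := s - 2) (v := v) n ht
  have hre : (s - 2).re + 1 = s.re - 1 := by simp; ring
  have hparts := integral_Ioi_mul_deriv_eq_deriv_mul (a := 0) (a' := 0) (b' := 0)
    (u := fun t : ℝ => (t : ℂ) ^ (s - 2)) (u' := fun t : ℝ => (s - 2) * (t : ℂ) ^ (s - 3))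
    (fun t ht => by
      convert! hasDerivAt_ofReal_cpow_const (ne_of_gt ht) (sub_ne_zero.2 hs2) using 3
      ring)
    (fun t _ => hF t) ?_ ?_ ?_ ?_
  · rw [sub_zero, zero_sub] at hparts
    simp_rw [hexpand, mul_assoc (s - 2)] at hparts
    rw [integral_finsetSum _ fun l _ => hint l, integral_const_mul, eq_comm, neg_eq_iff_eq_neg]
      at hparts
    rw [hparts, ← sum_neg_distrib, mul_sum]
    refine sum_congr rfl fun l _ => ?_
    rw [integral_const_mul, integral_cpow_mul_cexp hs1 (hlv l)]
    have hne : (l : ℂ) + v ≠ 0 := fun h => by simpa [h] using hlv l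
    rw [show 2 - s = -(s - 1) + 1 by ring, Complex.cpow_add _ _ hne, Complex.cpow_one]
    ring
  · refine (integrable_finsetSum (range (n + 2)) fun l _ => hint l).congr ?_
    exact Eventually.of_forall fun t => (hexpand t).symm
  · refine Integrable.mono' (((integrableOn_rpow_mul_exp_neg_mul hs1 hv)).const_mul ‖s - 2‖)
      (ContinuousOn.aestronglyMeasurable (fun t ht => ?_) measurableSet_Ioi) ?_
    · have := Complex.continuousAt_ofReal_cpow_const t (s - 3) (Or.inr (ne_of_gt ht))
      exact ((continuousAt_const.mul this).mul (by fun_prop)).continuousWithinAt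
    · filter_upwards [ae_restrict_mem measurableSet_Ioi] with t ht
      rw [Pi.mul_apply, mul_assoc, norm_mul]
      refine mul_le_mul_of_nonneg_left ?_ (norm_nonneg _)
      convert! norm_cpow_mul_cexp_mul_pow_le (s := s - 3) (v := v) n ht using 3
      simp; ring
  · refine squeeze_zero_norm' (a := fun t : ℝ => t ^ (s.re - 1) * Real.exp (-v.re * t)) ?_ ?_
    · filter_upwards [self_mem_nhdsWithin] with t ht
      rw [← hre]
      exact hbd t ht
    · have : ContinuousAt (fun t : ℝ => t ^ (s.re - 1) * Real.exp (-v.re * t)) 0 :=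
        (Real.continuousAt_rpow_const _ _ (Or.inr (by linarith))).mul (by fun_prop)
      simpa [ContinuousAt, Real.zero_rpow (sub_ne_zero.2 hs.ne')] using
        this.tendsto.mono_left (nhdsWithin_le_nhds (s := Ioi 0))
  · refine squeeze_zero_norm' ?_ (tendsto_rpow_mul_exp_neg_mul_atTop_nhds_zero (s.re - 1) _ hv)
    filter_upwards [eventually_gt_atTop 0] with t ht
    rw [← hre]
    exact hbd t ht

/-- Series with harmonic numbers for the Hurwitz zeta function: for complex `s, v` with
`Re s > 1`, `s ≠ 2` and `Re v > 0`,
`Σ_{n=0}^∞ (n+v)^{−s} = (2/((s−1)(s−2))) Σ_{n=0}^∞ (H_{n+1}/(n+2))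
  Σ_{l=0}^{n+1} (−1)^l C(n+1,l) (l+v)^{2−s}`,
the outer series being convergent, where `H_n` is the `n`-th harmonic number. -/
theorem hurwitz_harmonic_series (s v : ℂ) (hs : 1 < s.re) (hs2 : s ≠ 2) (hv : 0 < v.re) :
    ∃ L : ℂ,
      Tendsto (fun N : ℕ => ∑ n ∈ Finset.range N,
          ((harmonic (n + 1) : ℂ) / ((n : ℂ) + 2)) *
          ∑ l ∈ Finset.range (n + 2), (-1) ^ l * ((n + 1).choose l : ℂ) *
            ((l : ℂ) + v) ^ (2 - s))
        atTop (nhds L) ∧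
      (∑' n : ℕ, ((n : ℂ) + v) ^ (-s)) = (2 / ((s - 1) * (s - 2))) * L := by
  have hs1 : s - 1 ≠ 0 := fun h => by
    rw [sub_eq_zero.1 h] at hs
    simp at hs
  have hs2' : s - 2 ≠ 0 := sub_ne_zero.2 hs2
  have hΓ : Complex.Gamma s = (s - 1) * Complex.Gamma (s - 1) := by
    simpa using Complex.Gamma_add_one (s - 1) hs1
  have hΓ1 : Complex.Gamma (s - 1) ≠ 0 :=
    Complex.Gamma_ne_zero_of_re_pos (by simpa using hs)
  have hΓ0 : Complex.Gamma s ≠ 0 := Complex.Gamma_ne_zero_of_re_pos (by linarith)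
  have hζ := ((hasSum_hurwitz_mul_Gamma hs hv).div_const (Complex.Gamma s)).tsum_eq
  simp_rw [mul_div_cancel_right₀ _ hΓ0] at hζ
  have hL := ((hasSum_integral_harmonic hs hv).mul_left
    ((s - 2) / (2 * Complex.Gamma (s - 1)))).tendsto_sum_nat
  refine ⟨_, hL.congr fun N => sum_congr rfl fun n _ => ?_, ?_⟩
  · have h := integral_cpow_mul_cexp_mul_pow hs hs2 hv n
    rw [mul_comm (Complex.Gamma _), ← div_eq_iff hΓ1] at h
    rw [← h]
    field_simp
  · rw [hζ, hΓ]
    field_simp
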